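/- Let 𝒩 be a nest on a complex Banach space X and 𝒜 = alg 𝒩. Suppose there exists a nontrivial idempotent P ∈ 𝒜 such that ran(P) ∈ 𝒩. If a linear map δ : 𝒜 → B(X) is Jordan derivable at some C ∈ 𝒜, then δ is a derivation. In particular, every C ∈ 𝒜 is a Jordan all-derivable point. -/

import Mathlib

set_option synthInstance.maxHeartbeats 1000000
set_option maxHeartbeats 1000000

/-- The algebra `alg ℒ` of all bounded operators leaving every member of `ℒ` invariant. -/
def algLat {X : Type*} [NormedAddCommGroup X] [NormedSpace ℂ X]
    (ℒ : Set (Submodule ℂ X)) : Subalgebra ℂ (X →L[ℂ] X) where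
  carrier := {T | ∀ K ∈ ℒ, ∀ x ∈ K, T x ∈ K}
  mul_mem' := by
    intro T S hT hS K hK x hx
    exact hT K hK _ (hS K hK x hx)
  add_mem' := by
    intro T S hT hS K hK x hx
    exact K.add_mem (hT K hK x hx) (hS K hK x hx)
  one_mem' := by
    intro K hK x hx
    exact hx
  algebraMap_mem' := by
    intro c K hK x hx
    show (algebraMap ℂ (X →L[ℂ] X) c) x ∈ K
    rw [Algebra.algebraMap_eq_smul_one]
    exact K.smul_mem c hx
  zero_mem' := by
    intro K hK x hx
    exact K.zero_mem

section JordanDefect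

variable {B : Type*} [Ring B] [Algebra ℂ B] {A : Subalgebra ℂ B}

/-- The bilinear map measuring the failure of the Jordan product rule for `δ`. -/
noncomputable def jordanDefect (δ : A →ₗ[ℂ] B) : A →ₗ[ℂ] A →ₗ[ℂ] B :=
  LinearMap.mk₂ ℂ
    (fun a b => δ (a * b + b * a) - (δ a * (b : B) + (a : B) * δ b + δ b * (a : B) + (b : B) * δ a))
    (by intro a a' b; simp only [add_mul, mul_add, map_add, Subalgebra.coe_add]; abel)
    (by
      intro c a b
      simp only [smul_mul_assoc, mul_smul_comm, map_add, map_smul, Subalgebra.coe_smul]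
      module)
    (by intro a b b'; simp only [add_mul, mul_add, map_add, Subalgebra.coe_add]; abel)
    (by
      intro c a b
      simp only [smul_mul_assoc, mul_smul_comm, map_add, map_smul, Subalgebra.coe_smul]
      module)

theorem jordanDefect_apply (δ : A →ₗ[ℂ] B) (a b : A) :
    jordanDefect δ a b =
      δ (a * b + b * a) - (δ a * (b : B) + (a : B) * δ b + δ b * (a : B) + (b : B) * δ a) :=
  rfl

theorem jordanDefect_comm (δ : A →ₗ[ℂ] B) (a b : A) :
    jordanDefect δ a b = jordanDefect δ b a := by
  rw [jordanDefect_apply, jordanDefect_apply, add_comm (a * b)]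
  abel

end JordanDefect

section FactorizationFamilies

variable {A B : Type*} [Ring A] [Algebra ℂ A] [AddCommGroup B] [Module ℂ B]

/-- Vanishing of a bilinear map on the factorizations of `C` whose left factor is
invertible in the upper left corner. -/
theorem bilin_eq_of_left_corner (D : A →ₗ[ℂ] A →ₗ[ℂ] B) {C P Q u v m : A}
    (hD : ∀ a b, a * b = C → D a b = 0)
    (hPQ : P + Q = 1) (huv : u * v = P) (huQ : u * Q = 0) (hmv : m * v = 0) (hmQ : m * Q = m)
    (hPm : P * m = m) (hCv : Q * C * v = 0) (hQC : Q * C * Q = Q * C) :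
    D u Q = 0 ∧ D u (v * m) = D m Q ∧ D m (v * m) = 0 := by
  have key : ∀ s t : ℂ, s ≠ 0 →
      D (s • u + t • m + Q * C) (s⁻¹ • (v * C - t • (v * m)) + Q) = 0 := by
    intro s t hs
    apply hD
    have e1 : u * (v * C) = P * C := by rw [← mul_assoc, huv]
    have e2 : u * (v * m) = m := by rw [← mul_assoc, huv, hPm]
    have e3 : ∀ z, m * (v * z) = 0 := fun z => by rw [← mul_assoc, hmv, zero_mul]
    have e4 : ∀ z, Q * C * (v * z) = 0 := fun z => by rw [← mul_assoc, hCv, zero_mul]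
    have e5 : C = P * C + Q * C := by rw [← add_mul, hPQ, one_mul]
    conv_rhs => rw [e5]
    simp only [add_mul, mul_add, mul_sub, smul_mul_assoc, mul_smul_comm, e1, e2, e3, e4, huQ, hmQ,
      hQC, smul_sub, smul_smul, smul_zero]
    linear_combination (norm := module) (mul_inv_cancel₀ hs) • (P * C - t • m)
  simp only [map_add, map_sub, map_smul, LinearMap.add_apply, LinearMap.smul_apply] at key
  have k1 := key 1 0 one_ne_zero
  have k2 := key (-1) 0 (by norm_num)
  have k3 := key 2 0 two_ne_zero
  have k4 := key 1 1 one_ne_zero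
  have k5 := key 1 (-1) one_ne_zero
  have k6 := key (-1) 1 (by norm_num)
  refine ⟨?_, ?_, ?_⟩
  · linear_combination (norm := module) (2/3 : ℂ) • k3 - (1/2 : ℂ) • k1 - (1/6 : ℂ) • k2
  · linear_combination (norm := module) (-1/2 : ℂ) • (k4 + k6 - k1 - k2)
  · linear_combination (norm := module) k1 - (1/2 : ℂ) • (k4 + k5)

/-- Vanishing of a bilinear map on the factorizations of `C` whose right factor is
invertible in the lower right corner. -/
theorem bilin_eq_of_right_corner (D : A →ₗ[ℂ] A →ₗ[ℂ] B) {C P Q u v m : A}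
    (hD : ∀ a b, a * b = C → D a b = 0)
    (hPQ : P + Q = 1) (hvu : v * u = Q) (hPu : P * u = 0) (hvm : v * m = 0) (hPm : P * m = m)
    (hmQ : m * Q = m) (hvC : v * (C * P) = 0) (hPC : P * (C * P) = C * P) :
    D P u = 0 ∧ D (m * v) u = D P m := by
  have key : ∀ s t : ℂ, s ≠ 0 →
      D (P + s⁻¹ • (C * v - t • (m * v))) (C * P + t • m + s • u) = 0 := by
    intro s t hs
    apply hD
    have e5 : C = C * P + C * Q := by rw [← mul_add, hPQ, mul_one]
    conv_rhs => rw [e5]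
    simp only [add_mul, mul_add, sub_mul, smul_mul_assoc, mul_smul_comm, mul_assoc, hvu, hPu, hvm,
      hPm, hmQ, hvC, hPC, mul_zero, smul_sub, smul_smul, smul_zero]
    linear_combination (norm := module) (mul_inv_cancel₀ hs) • (C * Q - t • m)
  simp only [map_add, map_sub, map_smul, LinearMap.add_apply, LinearMap.sub_apply,
    LinearMap.smul_apply] at key
  have k1 := key 1 0 one_ne_zero
  have k2 := key (-1) 0 (by norm_num)
  have k3 := key 2 0 two_ne_zero
  have k4 := key 1 1 one_ne_zero
  have k6 := key (-1) 1 (by norm_num)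
  refine ⟨?_, ?_⟩
  · linear_combination (norm := module) (2/3 : ℂ) • k3 - (1/2 : ℂ) • k1 - (1/6 : ℂ) • k2
  · linear_combination (norm := module) (-1/2 : ℂ) • (k4 + k6 - k1 - k2)

end FactorizationFamilies

section CornerFacts

variable {A B : Type*} [Ring A] [Algebra ℂ A] [AddCommGroup B] [Module ℂ B]

/-- If `1 - t • x` is invertible and `x` lies in the corner of the idempotent `P`, then
`P - t • x` is invertible in that corner. -/
theorem exists_corner_inverse {P x w : A} (hPP : P * P = P) (hPx : P * x = x) (hxP : x * P = x)
    {t : ℂ} (hw : (1 - t • x) * w = 1) (hw' : w * (1 - t • x) = 1) :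
    ∃ v, (P - t • x) * v = P ∧ v * (P - t • x) = P ∧ P * v = v ∧ v * P = v := by
  have h1 : (P - t • x) = P * (1 - t • x) := by rw [mul_sub, mul_one, mul_smul_comm, hPx]
  have h2 : (P - t • x) = (1 - t • x) * P := by rw [sub_mul, one_mul, smul_mul_assoc, hxP]
  have h3 : w * P = P * w := by
    calc w * P = w * P * ((1 - t • x) * w) := by rw [hw, mul_one]
      _ = w * (P * (1 - t • x)) * w := by noncomm_ring
      _ = w * ((1 - t • x) * P) * w := by rw [← h1, h2]
      _ = (w * (1 - t • x)) * P * w := by noncomm_ring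
      _ = P * w := by rw [hw', one_mul]
  refine ⟨P * w, ?_, ?_, ?_, ?_⟩
  · rw [← h3, ← mul_assoc, h1, mul_assoc P, hw, mul_one, hPP]
  · rw [h2, mul_assoc, ← mul_assoc w, hw', one_mul, hPP]
  · rw [← mul_assoc, hPP]
  · rw [mul_assoc, h3, ← mul_assoc, hPP]

variable (D : A →ₗ[ℂ] A →ₗ[ℂ] B) {C P Q : A}

theorem bilin_left_corner (hinv : ∀ x : A, ∃ t : ℂ, t ≠ 0 ∧ IsUnit (1 - t • x))
    (hD : ∀ a b, a * b = C → D a b = 0)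
    (hPQ : P + Q = 1) (hPP : P * P = P) (hQAP : ∀ a, Q * a * P = 0) :
    (∀ x, P * x = x → x * P = x → D x Q = 0) ∧
    (∀ x m, P * x = x → x * P = x → P * m = m → m * Q = m → D x m = D (x * m) Q) ∧
    (∀ m, P * m = m → m * Q = m → D m m = 0) := by
  have hQ : Q = 1 - P := eq_sub_of_add_eq' hPQ
  have hPQ0 : P * Q = 0 := by rw [hQ, mul_sub, mul_one, hPP, sub_self]
  have hQP0 : Q * P = 0 := by rw [hQ, sub_mul, one_mul, hPP, sub_self]
  have hQC : Q * C * Q = Q * C := by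
    conv_lhs => rw [hQ, mul_sub, mul_one, ← hQ, hQAP, sub_zero]
  have base : ∀ u v m, u * v = P → u * P = u → P * v = v → P * m = m → m * Q = m →
      D u Q = 0 ∧ D u (v * m) = D m Q ∧ D m (v * m) = 0 := by
    intro u v m huv huP hPv hPm hmQ
    apply bilin_eq_of_left_corner D hD hPQ huv _ _ hmQ hPm _ hQC
    · rw [← huP, mul_assoc, hPQ0, mul_zero]
    · rw [← hmQ, ← hPv, mul_assoc, ← mul_assoc Q, hQP0, zero_mul, mul_zero]
    · rw [← hPv, ← mul_assoc, hQAP, zero_mul]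
  have hPQD : D P Q = 0 := (base P P 0 hPP hPP hPP (by simp) (by simp)).1
  have hPm : ∀ m, P * m = m → m * Q = m → D P m = D m Q := by
    intro m h1 h2
    have := (base P P m hPP hPP hPP h1 h2).2.1
    rwa [h1] at this
  have corner : ∀ x, P * x = x → x * P = x → ∃ t : ℂ, t ≠ 0 ∧ D (P - t • x) Q = 0 ∧
      ∀ m, P * m = m → m * Q = m → D (P - t • x) m = D ((P - t • x) * m) Q := by
    intro x hPx hxP
    obtain ⟨t, ht, w, hw⟩ := hinv x
    obtain ⟨v, h1, h2, h3, h4⟩ := exists_corner_inverse (w := ↑w⁻¹) hPP hPx hxP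
      (by rw [← hw]; simp) (by rw [← hw]; simp)
    have huP : (P - t • x) * P = P - t • x := by rw [sub_mul, smul_mul_assoc, hPP, hxP]
    have hPu : P * (P - t • x) = P - t • x := by rw [mul_sub, mul_smul_comm, hPP, hPx]
    refine ⟨t, ht, (base _ v 0 h1 huP h3 (by simp) (by simp)).1, fun m hm hm' => ?_⟩
    have := (base _ v ((P - t • x) * m) h1 huP h3 (by rw [← mul_assoc, hPu])
      (by rw [mul_assoc, hm'])).2.1
    rwa [← mul_assoc, h2, hm] at this
  refine ⟨fun x hPx hxP => ?_, fun x m hPx hxP hm hm' => ?_, fun m hm hm' => ?_⟩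
  · obtain ⟨t, ht, h, -⟩ := corner x hPx hxP
    simpa [hPQD, ht] using h
  · obtain ⟨t, ht, -, h⟩ := corner x hPx hxP
    have := h m hm hm'
    simp only [map_sub, map_smul, LinearMap.sub_apply, LinearMap.smul_apply, sub_mul,
      smul_mul_assoc, hm, hPm m hm hm', sub_right_inj] at this
    exact smul_right_injective B ht this
  · have := (base P P m hPP hPP hPP hm hm').2.2
    rwa [hm] at this

theorem bilin_right_corner (hinv : ∀ x : A, ∃ t : ℂ, t ≠ 0 ∧ IsUnit (1 - t • x))
    (hD : ∀ a b, a * b = C → D a b = 0)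
    (hPQ : P + Q = 1) (hPP : P * P = P) (hQAP : ∀ a, Q * a * P = 0) :
    (∀ y, Q * y = y → y * Q = y → D P y = 0) ∧
    (∀ m y, P * m = m → m * Q = m → Q * y = y → y * Q = y → D m y = D P (m * y)) := by
  have hQ : Q = 1 - P := eq_sub_of_add_eq' hPQ
  have hP : P = 1 - Q := eq_sub_of_add_eq hPQ
  have hPQ0 : P * Q = 0 := by rw [hQ, mul_sub, mul_one, hPP, sub_self]
  have hQP0 : Q * P = 0 := by rw [hQ, sub_mul, one_mul, hPP, sub_self]
  have hQQ : Q * Q = Q := by conv_lhs => rw [hQ, mul_sub, mul_one, ← hQ, hQP0, sub_zero]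
  have hPC : P * (C * P) = C * P := by
    conv_lhs => rw [hP, sub_mul, one_mul, ← hP, ← mul_assoc, hQAP, sub_zero]
  have base : ∀ u v m, v * u = Q → Q * u = u → v * Q = v → P * m = m → m * Q = m →
      D P u = 0 ∧ D (m * v) u = D P m := by
    intro u v m hvu hQu hvQ hPm hmQ
    apply bilin_eq_of_right_corner D hD hPQ hvu _ _ hPm hmQ _ hPC
    · rw [← hQu, ← mul_assoc, hPQ0, zero_mul]
    · rw [← hPm, ← hvQ, mul_assoc, ← mul_assoc Q, hQP0, zero_mul, mul_zero]
    · rw [← hvQ, mul_assoc, ← mul_assoc Q, hQAP, mul_zero]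
  have hPQD : D P Q = 0 := (base Q Q 0 hQQ hQQ hQQ (by simp) (by simp)).1
  have hmQD : ∀ m, P * m = m → m * Q = m → D m Q = D P m := by
    intro m h1 h2
    have := (base Q Q m hQQ hQQ hQQ h1 h2).2
    rwa [h2] at this
  have corner : ∀ y, Q * y = y → y * Q = y → ∃ t : ℂ, t ≠ 0 ∧ D P (Q - t • y) = 0 ∧
      ∀ m, P * m = m → m * Q = m → D m (Q - t • y) = D P (m * (Q - t • y)) := by
    intro y hQy hyQ
    obtain ⟨t, ht, w, hw⟩ := hinv y
    obtain ⟨v, h1, h2, h3, h4⟩ := exists_corner_inverse (w := ↑w⁻¹) hQQ hQy hyQ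
      (by rw [← hw]; simp) (by rw [← hw]; simp)
    have huQ : (Q - t • y) * Q = Q - t • y := by rw [sub_mul, smul_mul_assoc, hQQ, hyQ]
    have hQu : Q * (Q - t • y) = Q - t • y := by rw [mul_sub, mul_smul_comm, hQQ, hQy]
    refine ⟨t, ht, (base _ v 0 h2 hQu h4 (by simp) (by simp)).1, fun m hm hm' => ?_⟩
    have := (base _ v (m * (Q - t • y)) h2 hQu h4 (by rw [← mul_assoc, hm])
      (by rw [mul_assoc, huQ])).2
    rwa [mul_assoc, h1, hm'] at this
  refine ⟨fun y hQy hyQ => ?_, fun m y hm hm' hQy hyQ => ?_⟩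
  · obtain ⟨t, ht, h, -⟩ := corner y hQy hyQ
    simpa [hPQD, ht] using h
  · obtain ⟨t, ht, -, h⟩ := corner y hQy hyQ
    have := h m hm hm'
    simp only [map_sub, map_smul, mul_sub, mul_smul_comm, hm', hmQD m hm hm',
      sub_right_inj] at this
    exact smul_right_injective B ht this

end CornerFacts

section Prime

variable {B : Type*} [Ring B]

theorem eq_zero_of_mul_mul_mul_mul_eq_zero
    (hprime : ∀ a c : B, (∀ b, a * b * c = 0) → a = 0 ∨ c = 0) {T : B}
    (hT : ∀ b, T * b * T * b * T = 0) : T = 0 := by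
  have hTbT : ∀ b, T * b * T = 0 := by
    intro b
    refine (hprime (T * b * T) (T * b * T) fun c => ?_).elim id id
    have h := hT (b + b * T * c)
    have h1 := hT b
    have h2 := hT (b * T * c)
    calc T * b * T * c * (T * b * T)
        = T * (b + b * T * c) * T * (b + b * T * c) * T - T * b * T * b * T
            - T * (b * T * c) * T * (b * T * c) * T - T * b * T * b * T * c * T := by noncomm_ring
      _ = 0 := by rw [h, h1, h2]; simp
  exact (hprime T T hTbT).elim id id

theorem mul_eq_zero_of_idempotent_anticomm [Module ℂ B] {q d : B} (hq : q * q = q)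
    (h : d * q + q * d = 0) : q * d = 0 ∧ d * q = 0 := by
  have h1 : (2 : ℂ) • (q * d * q) = 0 := by
    have := congrArg (fun z => q * z * q) h
    simp only [mul_add, add_mul, mul_assoc, hq, mul_zero, zero_mul] at this
    rw [← mul_assoc q q, hq] at this
    rw [two_smul, mul_assoc, this]
  have h2 : q * d * q = 0 := (smul_eq_zero.mp h1).resolve_left two_ne_zero
  have h3 : q * d = 0 := by
    have := congrArg (fun z => q * z) h
    simpa only [mul_add, ← mul_assoc, hq, mul_zero, h2, zero_add] using this
  exact ⟨h3, by simpa [h3] using h⟩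

end Prime

section Derivation

variable {B : Type*} [Ring B] [Algebra ℂ B] {A : Subalgebra ℂ B}

theorem map_idempotent_eq_zero (hprime : ∀ a c : B, (∀ b, a * b * c = 0) → a = 0 ∨ c = 0)
    (hinv : ∀ x : A, ∃ t : ℂ, t ≠ 0 ∧ IsUnit (1 - t • x))
    {P Q C : A} (hPQ : P + Q = 1) (hPP : P * P = P) (hQAP : ∀ a, Q * a * P = 0)
    (hmem : ∀ b : B, (P : B) * b * Q ∈ A) (hP0 : P ≠ 0) (hQ0 : Q ≠ 0)
    (δ : A →ₗ[ℂ] B) (hD : ∀ a b, a * b = C → jordanDefect δ a b = 0)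
    (hoff : (P : B) * δ P * Q = 0) (hoff' : (Q : B) * δ P * P = 0) :
    δ P = 0 ∧ δ Q = 0 := by
  obtain ⟨l1, l2, -⟩ := bilin_left_corner _ hinv hD hPQ hPP hQAP
  have hQ : Q = 1 - P := eq_sub_of_add_eq' hPQ
  have hPQ0 : P * Q = 0 := by rw [hQ, mul_sub, mul_one, hPP, sub_self]
  have hQP0 : Q * P = 0 := by rw [hQ, sub_mul, one_mul, hPP, sub_self]
  have hQQ : Q * Q = Q := by conv_lhs => rw [hQ, mul_sub, mul_one, ← hQ, hQP0, sub_zero]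
  have e1 := l1 P hPP hPP
  have e2 : ∀ m, P * m = m → m * Q = m → jordanDefect δ P m = jordanDefect δ m Q := by
    intro m h1 h2
    have := l2 P m hPP hPP h1 h2
    rwa [h1] at this
  have e3 : C = 0 → ∀ m, m * Q = m → jordanDefect δ m P = 0 := by
    intro h m hm
    apply hD
    rw [h, ← hm, mul_assoc, hQP0, mul_zero]
  have e4 := hD 1 C (one_mul C)
  have hmem' : ∀ b : B, ∃ m : A, (m : B) = P * b * Q ∧ P * m = m ∧ m * Q = m := by
    intro b
    refine ⟨⟨_, hmem b⟩, rfl, Subtype.ext ?_, Subtype.ext ?_⟩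
    · simp only [Subalgebra.coe_mul, ← mul_assoc]; rw [← Subalgebra.coe_mul, hPP]
    · simp only [Subalgebra.coe_mul, mul_assoc]; rw [← Subalgebra.coe_mul, hQQ]
  have hp0 : (P : B) ≠ 0 := by simpa using hP0
  have hq0 : (Q : B) ≠ 0 := by simpa using hQ0
  have pp : (P : B) * P = P := by rw [← Subalgebra.coe_mul, hPP]
  have qq : (Q : B) * Q = Q := by rw [← Subalgebra.coe_mul, hQQ]
  have pq : (P : B) * Q = 0 := by rw [← Subalgebra.coe_mul, hPQ0]; rfl
  have qp : (Q : B) * P = 0 := by rw [← Subalgebra.coe_mul, hQP0]; rfl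
  have pq1 : (P : B) + Q = 1 := by rw [← Subalgebra.coe_add, hPQ]; rfl
  have qcp : (Q : B) * C * P = 0 := by
    rw [← Subalgebra.coe_mul, ← Subalgebra.coe_mul, hQAP]; rfl
  have h1 : δ 1 = δ P + δ Q := by rw [← hPQ, map_add]
  have hcc : C = 0 ∨ (C : B) ≠ 0 := by
    by_cases h : C = 0
    · exact Or.inl h
    · exact Or.inr (by simpa using h)
  simp only [jordanDefect_apply] at e1 e2 e3 e4
  rw [hPQ0, hQP0, add_zero, map_zero, zero_sub, neg_eq_zero] at e1
  rw [one_mul, mul_one, h1] at e4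
  generalize (δ P) = e at *
  generalize (δ Q) = h at *
  generalize hp : (P : B) = p at *
  generalize hq : (Q : B) = q at *
  have pp' : ∀ z, p * (p * z) = p * z := fun z => by rw [← mul_assoc, pp]
  have qq' : ∀ z, q * (q * z) = q * z := fun z => by rw [← mul_assoc, qq]
  have pq' : ∀ z, p * (q * z) = 0 := fun z => by rw [← mul_assoc, pq, zero_mul]
  have qp' : ∀ z, q * (p * z) = 0 := fun z => by rw [← mul_assoc, qp, zero_mul]
  have two : ∀ z : B, z + z = 0 → z = 0 := fun z hz => by
    rw [← two_smul ℂ] at hz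
    exact (smul_eq_zero.mp hz).resolve_left two_ne_zero
  have decomp : ∀ z, z = p * z * p + p * z * q + q * z * p + q * z * q := fun z => by
    calc z = (p + q) * z * (p + q) := by rw [pq1, one_mul, mul_one]
      _ = _ := by noncomm_ring
  -- The values at the idempotents lie in the diagonal corners.
  have he : e = p * e * p := by
    have : q * e * q = 0 := by
      apply two
      simpa [mul_add, add_mul, mul_assoc, pp, qq, pq, qp, pp', qq', pq', qp'] using
        congrArg (fun z => q * z * q) e1
    conv_lhs => rw [decomp e, hoff, hoff', this]
    simp
  have hh : h = q * h * q := by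
    have a1 : p * h * p = 0 := by
      apply two
      simpa [mul_add, add_mul, mul_assoc, pp, qq, pq, qp, pp', qq', pq', qp'] using
        congrArg (fun z => p * z * p) e1
    have a2 : p * h * q = 0 := by
      simp only [mul_assoc] at hoff
      simpa [mul_add, add_mul, mul_assoc, pp, qq, pq, qp, pp', qq', pq', qp', hoff] using
        congrArg (fun z => p * z * q) e1
    have a3 : q * h * p = 0 := by
      simp only [mul_assoc] at hoff'
      simpa [mul_add, add_mul, mul_assoc, pp, qq, pq, qp, pp', qq', pq', qp', hoff'] using
        congrArg (fun z => q * z * p) e1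
    conv_lhs => rw [decomp h, a1, a2, a3]
    simp
  have pe : p * e = e := by rw [he]; simp only [mul_assoc, pp']
  have ep : e * p = e := by rw [he]; simp only [mul_assoc, pp]
  have eq : e * q = 0 := by rw [he]; simp only [mul_assoc, pq, mul_zero]
  have qe : q * e = 0 := by rw [he]; simp only [mul_assoc, qp']
  have qh : q * h = h := by rw [hh]; simp only [mul_assoc, qq']
  have hhq : h * q = h := by rw [hh]; simp only [mul_assoc, qq]
  have hp' : h * p = 0 := by rw [hh]; simp only [mul_assoc, qp, mul_zero]
  have ph : p * h = 0 := by rw [hh]; simp only [mul_assoc, pq']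
  have pe' : ∀ z, p * (e * z) = e * z := fun z => by rw [← mul_assoc, pe]
  have ep' : ∀ z, e * (p * z) = e * z := fun z => by rw [← mul_assoc, ep]
  have eq' : ∀ z, e * (q * z) = 0 := fun z => by rw [← mul_assoc, eq, zero_mul]
  have qe' : ∀ z, q * (e * z) = 0 := fun z => by rw [← mul_assoc, qe, zero_mul]
  have qh' : ∀ z, q * (h * z) = h * z := fun z => by rw [← mul_assoc, qh]
  have hhq' : ∀ z, h * (q * z) = h * z := fun z => by rw [← mul_assoc, hhq]
  have hp'' : ∀ z, h * (p * z) = 0 := fun z => by rw [← mul_assoc, hp', zero_mul]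
  have ph' : ∀ z, p * (h * z) = 0 := fun z => by rw [← mul_assoc, ph, zero_mul]
  have key : ∀ b, e * (b * q) = p * (b * h) := by
    intro b
    obtain ⟨m, hm, hPm, hmQ⟩ := hmem' b
    have hmP : m * P = 0 := by rw [← hmQ, mul_assoc, hQP0, mul_zero]
    have hQm : Q * m = 0 := by rw [← hPm, ← mul_assoc, hQP0, zero_mul]
    have := e2 m hPm hmQ
    rw [hPm, hmQ, hmP, hQm, hm] at this
    simpa [mul_add, add_mul, mul_sub, sub_mul, mul_assoc, pp, qq, pq, qp, pp', qq', pq', qp', pe,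
      ep, eq, qe, qh, hhq, hp', ph, pe', ep', eq', qe', qh', hhq', hp'', ph', sub_eq_iff_eq_add,
      add_assoc] using congrArg (fun z => p * z * q) this
  have fin : e = 0 → e = 0 ∧ h = 0 := by
    intro h0
    refine ⟨h0, (hprime p h fun b => ?_).resolve_left hp0⟩
    rw [mul_assoc, ← key, h0, zero_mul]
  apply fin
  rcases hcc with hc | hc
  · refine (hprime e q fun b => ?_).resolve_right hq0
    obtain ⟨m, hm, hPm, hmQ⟩ := hmem' b
    have hmP : m * P = 0 := by rw [← hmQ, mul_assoc, hQP0, mul_zero]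
    have := e3 hc m hmQ
    rw [hPm, hmP, hm] at this
    simpa [mul_add, add_mul, mul_sub, sub_mul, mul_assoc, pp, qq, pq, qp, pp', qq', pq', qp', pe,
      ep, eq, qe, qh, hhq, hp', ph, pe', ep', eq', qe', qh', hhq', hp'', ph'] using
      congrArg (fun z => p * z * q) this
  · generalize (C : B) = c at *
    have ecomm : ∀ b, e * (b * p) = p * (b * e) := by
      intro b
      have := (hprime (e * (b * p) - p * (b * e)) q fun b' => ?_).resolve_right hq0
      · exact sub_eq_zero.mp this
      · have k1 := key (b * (p * b'))
        have k2 := key b'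
        simp only [mul_assoc] at k1
        simp only [sub_mul, mul_assoc, k1, k2, sub_self]
    have hcomm : ∀ b, h * (b * q) = q * (b * h) := by
      intro b
      have := (hprime p (h * (b * q) - q * (b * h)) fun b' => ?_).resolve_left hp0
      · exact sub_eq_zero.mp this
      · have k1 := key (b' * (q * b))
        have k2 := key b'
        simp only [mul_assoc] at k1
        have k3 := congrArg (fun z => z * (b * q)) k2
        simp only [mul_assoc] at k3
        simp only [mul_sub, mul_assoc, ← k1, ← k3, sub_self]
    have hqc : q * (c * p) = 0 := by rw [← mul_assoc, qcp]
    have e5 : (e + h) * c + c * (e + h) = 0 := by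
      rw [map_add] at e4
      have := neg_eq_zero.mpr e4
      rw [← this]
      simp only [Subalgebra.coe_one]
      noncomm_ring
    have ecp : e * (c * p) = 0 := by
      apply two
      simpa [mul_add, add_mul, mul_assoc, pp, qq, pq, qp, pp', qq', pq', qp', pe,
        ep, eq, qe, qh, hhq, hp', ph, pe', ep', eq', qe', qh', hhq', hp'', ph', ← ecomm] using
        congrArg (fun z => p * z * p) e5
    have ecq : e * (c * q) = 0 := by
      apply two
      simpa [mul_add, add_mul, mul_assoc, pp, qq, pq, qp, pp', qq', pq', qp', pe,
        ep, eq, qe, qh, hhq, hp', ph, pe', ep', eq', qe', qh', hhq', hp'', ph', ← key] using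
        congrArg (fun z => p * z * q) e5
    have hcq : h * (c * q) = 0 := by
      apply two
      simpa [mul_add, add_mul, mul_assoc, pp, qq, pq, qp, pp', qq', pq', qp', pe,
        ep, eq, qe, qh, hhq, hp', ph, pe', ep', eq', qe', qh', hhq', hp'', ph', ← hcomm] using
        congrArg (fun z => q * z * q) e5
    have ec : e * c = 0 := by
      rw [← mul_one c, ← pq1, mul_add, mul_add, ecp, ecq, add_zero]
    have hc0 : h * c = 0 := by
      rw [← mul_one c, ← pq1, mul_add, mul_add, hcq, ← hhq', hqc, mul_zero, add_zero]
    refine (hprime e c fun b => ?_).resolve_right hc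
    have k1 := congrArg (fun z => z * c) (ecomm b)
    have k2 := congrArg (fun z => z * c) (key b)
    simp only [mul_assoc, ec, hc0, mul_zero] at k1 k2
    rw [mul_assoc, ← one_mul c, ← pq1, add_mul, mul_add, mul_add, k1, k2, add_zero]

theorem isDerivation_of_map_idempotent_eq_zero
    (hprime : ∀ a c : B, (∀ b, a * b * c = 0) → a = 0 ∨ c = 0)
    (hinv : ∀ x : A, ∃ t : ℂ, t ≠ 0 ∧ IsUnit (1 - t • x))
    {P Q C : A} (hPQ : P + Q = 1) (hPP : P * P = P) (hQAP : ∀ a, Q * a * P = 0)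
    (hmem : ∀ b : B, (P : B) * b * Q ∈ A) (hP0 : P ≠ 0) (hQ0 : Q ≠ 0)
    (δ : A →ₗ[ℂ] B) (hD : ∀ a b, a * b = C → jordanDefect δ a b = 0)
    (hδP : δ P = 0) (hδQ : δ Q = 0) (a b : A) :
    δ (a * b) = δ a * (b : B) + (a : B) * δ b := by
  obtain ⟨l1, l2, l3⟩ := bilin_left_corner _ hinv hD hPQ hPP hQAP
  obtain ⟨r1, r2⟩ := bilin_right_corner _ hinv hD hPQ hPP hQAP
  have hQ : Q = 1 - P := eq_sub_of_add_eq' hPQ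
  have hPQ0 : P * Q = 0 := by rw [hQ, mul_sub, mul_one, hPP, sub_self]
  have hQP0 : Q * P = 0 := by rw [hQ, sub_mul, one_mul, hPP, sub_self]
  have hQQ : Q * Q = Q := by conv_lhs => rw [hQ, mul_sub, mul_one, ← hQ, hQP0, sub_zero]
  have hmem' : ∀ b : B, ∃ m : A, (m : B) = P * b * Q ∧ P * m = m ∧ m * Q = m := by
    intro b
    refine ⟨⟨_, hmem b⟩, rfl, Subtype.ext ?_, Subtype.ext ?_⟩
    · simp only [Subalgebra.coe_mul, ← mul_assoc]; rw [← Subalgebra.coe_mul, hPP]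
    · simp only [Subalgebra.coe_mul, mul_assoc]; rw [← Subalgebra.coe_mul, hQQ]
  have hp0 : (P : B) ≠ 0 := by simpa using hP0
  have hq0 : (Q : B) ≠ 0 := by simpa using hQ0
  have pp : (P : B) * P = P := by rw [← Subalgebra.coe_mul, hPP]
  have qq : (Q : B) * Q = Q := by rw [← Subalgebra.coe_mul, hQQ]
  have pq : (P : B) * Q = 0 := by rw [← Subalgebra.coe_mul, hPQ0]; rfl
  have qp : (Q : B) * P = 0 := by rw [← Subalgebra.coe_mul, hQP0]; rfl
  have pq1 : (P : B) + Q = 1 := by rw [← Subalgebra.coe_add, hPQ]; rfl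
  have two : ∀ z : B, z + z = 0 → z = 0 := fun z hz => by
    rw [← two_smul ℂ] at hz
    exact (smul_eq_zero.mp hz).resolve_left two_ne_zero
  -- `δ` respects the corners.
  have dx : ∀ x, P * x = x → x * P = x → (Q : B) * δ x = 0 ∧ δ x * (Q : B) = 0 := by
    intro x hPx hxP
    have h1 : x * Q = 0 := by rw [← hxP, mul_assoc, hPQ0, mul_zero]
    have h2 : Q * x = 0 := by rw [← hPx, ← mul_assoc, hQP0, zero_mul]
    have := l1 x hPx hxP
    rw [jordanDefect_apply, h1, h2, hδQ, add_zero, map_zero, zero_sub, neg_eq_zero] at this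
    exact mul_eq_zero_of_idempotent_anticomm qq (by simpa [add_comm] using this)
  have dy : ∀ y, Q * y = y → y * Q = y → (P : B) * δ y = 0 ∧ δ y * (P : B) = 0 := by
    intro y hQy hyQ
    have h1 : y * P = 0 := by rw [← hyQ, mul_assoc, hQP0, mul_zero]
    have h2 : P * y = 0 := by rw [← hQy, ← mul_assoc, hPQ0, zero_mul]
    have := r1 y hQy hyQ
    rw [jordanDefect_apply, h1, h2, hδP, add_zero, map_zero, zero_sub, neg_eq_zero] at this
    exact mul_eq_zero_of_idempotent_anticomm pp (by simpa [add_comm] using this)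
  have mP : ∀ m, m * Q = m → m * P = 0 := fun m h => by rw [← h, mul_assoc, hQP0, mul_zero]
  have Qm : ∀ m, P * m = m → Q * m = 0 := fun m h => by rw [← h, ← mul_assoc, hQP0, zero_mul]
  have mm : ∀ m n, m * Q = m → P * n = n → m * n = 0 := fun m n h h' => by
    rw [← h, mul_assoc, Qm n h', mul_zero]
  have dm_sq : ∀ m, P * m = m → m * Q = m → (m : B) * δ m + δ m * m = 0 := by
    intro m h1 h2
    have := l3 m h1 h2
    rw [jordanDefect_apply, mm m m h2 h1, add_zero, map_zero, zero_sub, neg_eq_zero] at this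
    apply two
    rw [← this]
    abel
  have dm_pol : ∀ m n, P * m = m → m * Q = m → P * n = n → n * Q = n →
      (m : B) * δ n * P + n * δ m * P = 0 := by
    intro m n h1 h2 h3 h4
    have k1 := dm_sq m h1 h2
    have k2 := dm_sq n h3 h4
    have k3 := dm_sq (m + n) (by rw [mul_add, h1, h3]) (by rw [add_mul, h2, h4])
    have mP' : (m : B) * P = 0 := by rw [← Subalgebra.coe_mul, mP m h2]; rfl
    have nP' : (n : B) * P = 0 := by rw [← Subalgebra.coe_mul, mP n h4]; rfl
    have k4 : ((m : B) * δ n + n * δ m) + (δ m * n + δ n * m) = 0 := by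
      simp only [map_add, Subalgebra.coe_add] at k3
      calc _ = ((m + n : B) * (δ m + δ n) + (δ m + δ n) * (m + n))
            - (m * δ m + δ m * m) - (n * δ n + δ n * n) := by noncomm_ring
        _ = 0 := by rw [k1, k2, k3]; simp
    simpa [add_mul, mul_assoc, mP', nP'] using congrArg (fun z => z * (P : B)) k4
  have coeP : ∀ m, P * m = m → (P : B) * m = m := fun m h => by rw [← Subalgebra.coe_mul, h]
  have coeQ : ∀ m, m * Q = m → (m : B) * Q = m := fun m h => by rw [← Subalgebra.coe_mul, h]
  have dm21 : ∀ n, P * n = n → n * Q = n → (Q : B) * δ n * P = 0 := by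
    intro n h3 h4
    apply eq_zero_of_mul_mul_mul_mul_eq_zero hprime
    intro b
    obtain ⟨m, hm, h1, h2⟩ := hmem' b
    have k1 : (Q : B) * δ m * m = 0 := by
      have := congrArg (fun z => (Q : B) * z) (dm_sq m h1 h2)
      have Qm' : (Q : B) * m = 0 := by rw [← Subalgebra.coe_mul, Qm m h1]; rfl
      simpa [mul_add, ← mul_assoc, Qm'] using this
    have k2 : (m : B) * δ n * m = 0 := by
      calc (m : B) * δ n * m = (m * δ n * P + n * δ m * P) * m - n * δ m * (P * m) := by
            conv_lhs => rw [← coeP m h1]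
            simp only [coeP m h1, add_mul, mul_assoc]
            abel
        _ = - (n * Q * δ m * m) := by
            rw [dm_pol m n h1 h2 h3 h4, coeP m h1, coeQ n h4]; simp
        _ = 0 := by rw [mul_assoc, mul_assoc, ← mul_assoc (Q : B), k1]; simp
    rw [hm] at k2
    calc _ = (Q : B) * δ n * (P * b * Q * δ n * (P * b * Q)) * δ n * P := by noncomm_ring
      _ = 0 := by rw [k2]; simp
  have dm : ∀ m, P * m = m → m * Q = m →
      (Q : B) * δ m = 0 ∧ δ m * (P : B) = 0 ∧ (P : B) * δ m = δ m ∧ δ m * (Q : B) = δ m := by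
    intro m h1 h2
    have k := l2 P m hPP hPP h1 h2
    rw [h1, jordanDefect_apply, jordanDefect_apply, h1, h2, mP m h2, Qm m h1, hδP, hδQ] at k
    simp only [add_zero, mul_zero, zero_mul, zero_add, sub_right_inj] at k
    have k' : (P : B) * δ m + δ m * P = δ m * Q + Q * δ m := by
      simpa [add_comm] using k
    have a1 : (P : B) * δ m * P = 0 := by
      apply two
      have := congrArg (fun z => (P : B) * z * P) k'
      simp only [mul_add, add_mul, mul_assoc, pp, qp, mul_zero] at this
      simpa only [← mul_assoc, pp, pq, zero_mul, add_zero, zero_add] using this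
    have a2 : (Q : B) * δ m * Q = 0 := by
      apply two
      have := congrArg (fun z => (Q : B) * z * Q) k'
      simp only [mul_add, add_mul, mul_assoc, qq, pq, mul_zero] at this
      simpa only [← mul_assoc, qq, qp, zero_mul, add_zero, zero_add] using this.symm
    have b1 : (Q : B) * δ m = 0 := by
      rw [← mul_one ((Q : B) * δ m), ← pq1, mul_add, dm21 m h1 h2, a2, add_zero]
    have b2 : δ m * (P : B) = 0 := by
      rw [← one_mul (δ m * (P : B)), ← pq1, add_mul, ← mul_assoc, ← mul_assoc, dm21 m h1 h2, a1,
        add_zero]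
    refine ⟨b1, b2, ?_, ?_⟩
    · rw [← one_mul (δ m), ← pq1, add_mul, b1, add_zero, ← mul_assoc, pp]
    · rw [← mul_one (δ m), ← pq1, mul_add, b2, zero_add, mul_assoc, qq]
  have ann : ∀ u v : B, u * Q = 0 → (Q : B) * v = v → u * v = 0 := fun u v h1 h2 => by
    rw [← h2, ← mul_assoc, h1, zero_mul]
  have ann' : ∀ u v : B, u * P = 0 → (P : B) * v = v → u * v = 0 := fun u v h1 h2 => by
    rw [← h2, ← mul_assoc, h1, zero_mul]
  have toP : ∀ v : B, (Q : B) * v = 0 → (P : B) * v = v := fun v h => by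
    rw [← one_mul v, ← pq1, add_mul, h, add_zero, ← mul_assoc, pp]
  have toQ : ∀ v : B, (P : B) * v = 0 → (Q : B) * v = v := fun v h => by
    rw [← one_mul v, ← pq1, add_mul, h, zero_add, ← mul_assoc, qq]
  have coe0 : ∀ u v : A, u * v = 0 → (u : B) * v = 0 := fun u v h => by
    rw [← Subalgebra.coe_mul, h]; rfl
  -- The product rule on the corners.
  have rxm : ∀ x m, P * x = x → x * P = x → P * m = m → m * Q = m →
      δ (x * m) = δ x * (m : B) + (x : B) * δ m := by
    intro x m h1 h2 h3 h4
    have k := l2 x m h1 h2 h3 h4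
    obtain ⟨c1, -, -, c4⟩ := dm (x * m) (by rw [← mul_assoc, h1]) (by rw [mul_assoc, h4])
    have hmx : m * x = 0 := mm m x h4 h1
    rw [jordanDefect_apply, jordanDefect_apply, hmx, Qm (x * m) (by rw [← mul_assoc, h1]), mul_assoc,
      h4, hδQ, c1, c4, ann' (δ m) x (dm m h3 h4).2.1 (coeP x h1),
      ann' m (δ x) (coe0 _ _ (mP m h4)) (toP _ (dx x h1 h2).1)] at k
    simpa [sub_eq_zero] using k
  have rmy : ∀ m y, P * m = m → m * Q = m → Q * y = y → y * Q = y →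
      δ (m * y) = δ m * (y : B) + (m : B) * δ y := by
    intro m y h3 h4 h1 h2
    have k := r2 m y h3 h4 h1 h2
    obtain ⟨-, c2, c3, -⟩ := dm (m * y) (by rw [← mul_assoc, h3]) (by rw [mul_assoc, h2])
    have hyP : y * P = 0 := mP y h2
    have hym : y * m = 0 := by rw [← h2, mul_assoc, Qm m h3, mul_zero]
    rw [jordanDefect_apply, jordanDefect_apply, hym, mP (m * y) (by rw [mul_assoc, h2]),
      ← mul_assoc, h3, hδP, c2, c3, ann' (δ y) m (dy y h1 h2).2 (coeP m h3),
      ann' y (δ m) (coe0 _ _ hyP) (dm m h3 h4).2.2.1] at k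
    simpa [sub_eq_zero] using k
  have rxx : ∀ x x', P * x = x → x * P = x → P * x' = x' → x' * P = x' →
      δ (x * x') = δ x * (x' : B) + (x : B) * δ x' := by
    intro x x' h1 h2 h3 h4
    have k : δ (x * x') - (δ x * (x' : B) + (x : B) * δ x') = 0 := by
      have : (δ (x * x') - (δ x * (x' : B) + (x : B) * δ x')) * P = 0 := by
        refine (hprime _ (Q : B) fun b => ?_).resolve_right hq0
        obtain ⟨m, hm, h5, h6⟩ := hmem' b
        have k1 := rxm (x * x') m (by rw [← mul_assoc, h1]) (by rw [mul_assoc, h4]) h5 h6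
        have k2 := rxm x' m h3 h4 h5 h6
        have k3 := rxm x (x' * m) h1 h2 (by rw [← mul_assoc, h3]) (by rw [mul_assoc, h6])
        rw [mul_assoc, k3, k2] at k1
        rw [mul_assoc, mul_assoc, ← mul_assoc (P : B), ← hm]
        rw [sub_mul, eq_sub_of_add_eq k1.symm]
        simp only [Subalgebra.coe_mul]
        noncomm_ring
      rw [← mul_one (_ - _), ← pq1, mul_add, this, zero_add, sub_mul, add_mul,
        (dx (x * x') (by rw [← mul_assoc, h1]) (by rw [mul_assoc, h4])).2, mul_assoc, mul_assoc,
        (dx x' h3 h4).2, coe0 x' Q (by rw [← h4, mul_assoc, hPQ0, mul_zero])]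
      simp
    exact sub_eq_zero.mp k
  have ryy : ∀ y y', Q * y = y → y * Q = y → Q * y' = y' → y' * Q = y' →
      δ (y * y') = δ y * (y' : B) + (y : B) * δ y' := by
    intro y y' h1 h2 h3 h4
    have k : δ (y * y') - (δ y * (y' : B) + (y : B) * δ y') = 0 := by
      have : (Q : B) * (δ (y * y') - (δ y * (y' : B) + (y : B) * δ y')) = 0 := by
        refine (hprime (P : B) _ fun b => ?_).resolve_left hp0
        obtain ⟨m, hm, h5, h6⟩ := hmem' b
        have k1 := rmy m (y * y') h5 h6 (by rw [← mul_assoc, h1]) (by rw [mul_assoc, h4])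
        have k2 := rmy m y h5 h6 h1 h2
        have k3 := rmy (m * y) y' (by rw [← mul_assoc, h5]) (by rw [mul_assoc, h2]) h3 h4
        rw [← mul_assoc, k3, k2] at k1
        rw [← mul_assoc, ← hm, mul_sub, eq_sub_of_add_eq' k1.symm]
        simp only [Subalgebra.coe_mul]
        noncomm_ring
      rw [← one_mul (_ - _), ← pq1, add_mul, this, add_zero, mul_sub, mul_add,
        (dy (y * y') (by rw [← mul_assoc, h1]) (by rw [mul_assoc, h4])).1, ← mul_assoc, ← mul_assoc,
        (dy y h1 h2).1, coe0 P y (by rw [← h1, ← mul_assoc, hPQ0, zero_mul])]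
      simp
    exact sub_eq_zero.mp k
  have peirce : ∀ a : A, ∃ x m y : A, a = x + m + y ∧ (P * x = x ∧ x * P = x) ∧
      (P * m = m ∧ m * Q = m) ∧ (Q * y = y ∧ y * Q = y) := by
    intro a
    refine ⟨P * a * P, P * a * Q, Q * a * Q, ?_, ⟨?_, ?_⟩, ⟨?_, ?_⟩, ⟨?_, ?_⟩⟩
    · calc a = (P + Q) * a * (P + Q) := by rw [hPQ, one_mul, mul_one]
        _ = P * a * P + P * a * Q + Q * a * Q + Q * a * P := by noncomm_ring
        _ = _ := by rw [hQAP, add_zero]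
    all_goals first
      | rw [← mul_assoc, ← mul_assoc, hPP]
      | rw [← mul_assoc, ← mul_assoc, hQQ]
      | rw [mul_assoc, hPP]
      | rw [mul_assoc, hQQ]
  obtain ⟨x, m, y, rfl, ⟨hx, hx'⟩, ⟨hm, hm'⟩, ⟨hy, hy'⟩⟩ := peirce a
  obtain ⟨x', m', y', rfl, ⟨gx, gx'⟩, ⟨gm, gm'⟩, ⟨gy, gy'⟩⟩ := peirce b
  have hxQ : x * Q = 0 := by rw [← hx', mul_assoc, hPQ0, mul_zero]
  have hyP : y * P = 0 := mP y hy'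
  have z1 : x * y' = 0 := by rw [← gy, ← mul_assoc, hxQ, zero_mul]
  have z2 : m * x' = 0 := mm m x' hm' gx
  have z3 : m * m' = 0 := mm m m' hm' gm
  have z4 : y * x' = 0 := by rw [← gx, ← mul_assoc, hyP, zero_mul]
  have z5 : y * m' = 0 := by rw [← gm, ← mul_assoc, hyP, zero_mul]
  have hL : (x + m + y) * (x' + m' + y') = x * x' + x * m' + m * y' + y * y' := by
    simp only [add_mul, mul_add, z1, z2, z3, z4, z5]
    abel
  rw [hL]
  have w1 : δ x * (y' : B) = 0 := ann _ _ (dx x hx hx').2 (by rw [← Subalgebra.coe_mul, gy])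
  have w2 : δ m * (x' : B) = 0 := ann' _ _ (dm m hm hm').2.1 (coeP _ gx)
  have w3 : δ m * (m' : B) = 0 := ann' _ _ (dm m hm hm').2.1 (coeP _ gm)
  have w4 : δ y * (x' : B) = 0 := ann' _ _ (dy y hy hy').2 (coeP _ gx)
  have w5 : δ y * (m' : B) = 0 := ann' _ _ (dy y hy hy').2 (coeP _ gm)
  have w6 : (x : B) * δ y' = 0 := ann _ _ (coe0 _ _ hxQ) (toQ _ (dy y' gy gy').1)
  have w7 : (m : B) * δ x' = 0 := ann' _ _ (coe0 _ _ (mP m hm')) (toP _ (dx x' gx gx').1)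
  have w8 : (m : B) * δ m' = 0 := ann' _ _ (coe0 _ _ (mP m hm')) (dm m' gm gm').2.2.1
  have w9 : (y : B) * δ x' = 0 := ann' _ _ (coe0 _ _ hyP) (toP _ (dx x' gx gx').1)
  have w10 : (y : B) * δ m' = 0 := ann' _ _ (coe0 _ _ hyP) (dm m' gm gm').2.2.1
  simp only [map_add, Subalgebra.coe_add, add_mul, mul_add, rxx x x' hx hx' gx gx',
    rxm x m' hx hx' gm gm', rmy m y' hm hm' gy gy', ryy y y' hy hy' gy gy', w1, w2, w3, w4, w5, w6,
    w7, w8, w9, w10]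
  abel

/-- A linear map from a triangular subalgebra of a prime algebra which satisfies the Jordan product
rule on the factorizations of a single element is a derivation. -/
theorem isDerivation_of_jordanDefect_eq_zero
    (hprime : ∀ a c : B, (∀ b, a * b * c = 0) → a = 0 ∨ c = 0)
    (hinv : ∀ x : A, ∃ t : ℂ, t ≠ 0 ∧ IsUnit (1 - t • x))
    {P Q C : A} (hPQ : P + Q = 1) (hPP : P * P = P) (hQAP : ∀ a, Q * a * P = 0)
    (hmem : ∀ b : B, (P : B) * b * Q ∈ A) (hP0 : P ≠ 0) (hQ0 : Q ≠ 0)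
    (δ : A →ₗ[ℂ] B) (hD : ∀ a b, a * b = C → jordanDefect δ a b = 0) (a b : A) :
    δ (a * b) = δ a * (b : B) + (a : B) * δ b := by
  obtain ⟨s, hs⟩ : ∃ s : B, s = (P : B) * δ P * Q - Q * δ P * P := ⟨_, rfl⟩
  let ι : A →ₗ[ℂ] B := A.val.toLinearMap
  let δ' : A →ₗ[ℂ] B :=
    δ - ((LinearMap.mulRight ℂ s).comp ι - (LinearMap.mulLeft ℂ s).comp ι)
  have hδ' : ∀ a, δ' a = δ a - ((a : B) * s - s * a) := fun a => rfl
  have hD' : ∀ a b, jordanDefect δ' a b = jordanDefect δ a b := by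
    intro a b
    simp only [jordanDefect_apply, hδ', Subalgebra.coe_add, Subalgebra.coe_mul]
    noncomm_ring
  have hQ : Q = 1 - P := eq_sub_of_add_eq' hPQ
  have hPQ0 : P * Q = 0 := by rw [hQ, mul_sub, mul_one, hPP, sub_self]
  have hQP0 : Q * P = 0 := by rw [hQ, sub_mul, one_mul, hPP, sub_self]
  have hQQ : Q * Q = Q := by conv_lhs => rw [hQ, mul_sub, mul_one, ← hQ, hQP0, sub_zero]
  have pp : (P : B) * P = P := by rw [← Subalgebra.coe_mul, hPP]
  have qq : (Q : B) * Q = Q := by rw [← Subalgebra.coe_mul, hQQ]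
  have pq : (P : B) * Q = 0 := by rw [← Subalgebra.coe_mul, hPQ0]; rfl
  have qp : (Q : B) * P = 0 := by rw [← Subalgebra.coe_mul, hQP0]; rfl
  have pp' : ∀ z : B, (P : B) * (P * z) = P * z := fun z => by rw [← mul_assoc, pp]
  have qq' : ∀ z : B, (Q : B) * (Q * z) = Q * z := fun z => by rw [← mul_assoc, qq]
  have pq' : ∀ z : B, (P : B) * (Q * z) = 0 := fun z => by rw [← mul_assoc, pq, zero_mul]
  have qp' : ∀ z : B, (Q : B) * (P * z) = 0 := fun z => by rw [← mul_assoc, qp, zero_mul]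
  have hD0 : ∀ a b, a * b = C → jordanDefect δ' a b = 0 := fun a b h => by rw [hD', hD a b h]
  obtain ⟨h1, h2⟩ := map_idempotent_eq_zero hprime hinv hPQ hPP hQAP hmem hP0 hQ0 δ' hD0
    (by simp [hδ', hs, mul_add, mul_sub, sub_mul, mul_assoc, pp, qq, qp, pp', pq'])
    (by simp [hδ', hs, mul_add, mul_sub, sub_mul, mul_assoc, pp, qp, pp', qq', pq', qp'])
  have := isDerivation_of_map_idempotent_eq_zero hprime hinv hPQ hPP hQAP hmem hP0 hQ0 δ' hD0 h1 h2
    a b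
  simp only [hδ', Subalgebra.coe_mul] at this
  rw [sub_eq_iff_eq_add.mp this]
  noncomm_ring

end Derivation

section NestAlgebra

variable {X : Type*} [NormedAddCommGroup X] [NormedSpace ℂ X]

theorem eq_zero_or_eq_zero_of_forall_mul_mul_eq_zero (a c : X →L[ℂ] X)
    (h : ∀ b, a * b * c = 0) : a = 0 ∨ c = 0 := by
  by_contra! hac
  obtain ⟨ha, hc⟩ := hac
  obtain ⟨x, hx⟩ : ∃ x, c x ≠ 0 := by
    by_contra! h0
    exact hc (ContinuousLinearMap.ext h0)
  obtain ⟨f, hf⟩ := SeparatingDual.exists_eq_one (R := ℂ) hx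
  refine ha (ContinuousLinearMap.ext fun y => ?_)
  have := congrArg (fun T : X →L[ℂ] X => T x) (h (f.smulRight y))
  simpa [hf] using this

theorem isClosed_algLat {ℒ : Set (Submodule ℂ X)} (hcl : ∀ K ∈ ℒ, IsClosed (K : Set X)) :
    IsClosed (algLat ℒ : Set (X →L[ℂ] X)) := by
  have : (algLat ℒ : Set (X →L[ℂ] X)) = ⋂ K ∈ ℒ, ⋂ x ∈ K, {T | T x ∈ (K : Set X)} := by
    ext T
    simp only [Set.mem_iInter]
    rfl
  rw [this]
  exact isClosed_biInter fun K hK => isClosed_biInter fun x _ =>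
    (hcl K hK).preimage (ContinuousLinearMap.apply ℂ X x).continuous

theorem exists_isUnit_one_sub_smul {A : Type*} [NormedRing A] [NormedAlgebra ℂ A] [CompleteSpace A]
    (x : A) : ∃ t : ℂ, t ≠ 0 ∧ IsUnit (1 - t • x) := by
  have hpos : 0 < ‖x‖ + 1 := by positivity
  refine ⟨((‖x‖ + 1)⁻¹ : ℝ), by exact_mod_cast (inv_pos.mpr hpos).ne', ?_⟩
  apply isUnit_one_sub_of_norm_lt_one
  refine (norm_smul_le _ _).trans_lt ?_
  rw [Complex.norm_real, Real.norm_of_nonneg (inv_pos.mpr hpos).le, inv_mul_lt_one₀ hpos]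
  linarith

end NestAlgebra

/-- let `𝒩` be a nest (a totally ordered subspace lattice) on a complex Banach
space `X` and `𝒜 = alg 𝒩`. If there is a nontrivial idempotent `P ∈ 𝒜` with `ran(P) ∈ 𝒩`,
then every linear map `δ : 𝒜 → B(X)` which is Jordan derivable at some `C ∈ 𝒜` is a
derivation; in particular every `C ∈ 𝒜` is a Jordan all-derivable point. -/
theorem statement8 {X : Type*} [NormedAddCommGroup X] [NormedSpace ℂ X] [CompleteSpace X]
    -- `𝒩` is a nest: a totally ordered subspace lattice
    (𝒩 : Set (Submodule ℂ X))
    (hcl : ∀ K ∈ 𝒩, IsClosed (K : Set X))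
    (hbot : ⊥ ∈ 𝒩) (htop : ⊤ ∈ 𝒩)
    (hinf : ∀ S ⊆ 𝒩, sInf S ∈ 𝒩)
    (hsup : ∀ S ⊆ 𝒩, (sSup S).topologicalClosure ∈ 𝒩)
    (htotal : ∀ K ∈ 𝒩, ∀ L ∈ 𝒩, K ≤ L ∨ L ≤ K)
    -- a nontrivial idempotent `P ∈ alg 𝒩` with `ran(P) ∈ 𝒩`
    (P : X →L[ℂ] X) (hPmem : P ∈ algLat 𝒩)
    (hP : P * P = P) (hP0 : P ≠ 0) (hP1 : P ≠ 1)
    (hran : LinearMap.range (P : X →ₗ[ℂ] X) ∈ 𝒩)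
    -- `δ` is Jordan derivable at `C ∈ alg 𝒩`
    (C : algLat 𝒩) (δ : (algLat 𝒩) →ₗ[ℂ] (X →L[ℂ] X))
    (hδ : ∀ a b : algLat 𝒩, a * b = C →
      δ (a * b + b * a) = δ a * (b : X →L[ℂ] X) + (a : X →L[ℂ] X) * δ b
        + δ b * (a : X →L[ℂ] X) + (b : X →L[ℂ] X) * δ a) :
    -- `δ` is a derivation
    ∀ a b : algLat 𝒩, δ (a * b) = δ a * (b : X →L[ℂ] X) + (a : X →L[ℂ] X) * δ b := by
  have hcomplete : CompleteSpace (algLat 𝒩) := (isClosed_algLat hcl).completeSpace_coe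
  have hmap : ∀ x ∈ LinearMap.range (P : X →ₗ[ℂ] X), P x = x := by
    rintro _ ⟨z, rfl⟩
    exact congrArg (fun T : X →L[ℂ] X => T z) hP
  have hmem : ∀ b : X →L[ℂ] X, P * b * (1 - P) ∈ algLat 𝒩 := by
    intro b K hK x hx
    rcases htotal K hK _ hran with h | h
    · simp [hmap x (h hx)]
    · exact h ⟨_, rfl⟩
  refine isDerivation_of_jordanDefect_eq_zero eq_zero_or_eq_zero_of_forall_mul_mul_eq_zero
    exists_isUnit_one_sub_smul (P := ⟨P, hPmem⟩) (Q := 1 - ⟨P, hPmem⟩) (C := C)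
    (by simp) (Subtype.ext hP) (fun a => Subtype.ext (ContinuousLinearMap.ext fun x => ?_)) hmem
    (fun h => hP0 (congrArg Subtype.val h))
    (fun h => hP1 (congrArg Subtype.val (sub_eq_zero.mp h)).symm) δ
    (fun a b h => by rw [jordanDefect_apply, hδ a b h, sub_self])
  have := hmap _ (a.2 _ hran (P x) ⟨x, rfl⟩)
  simp [this]
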